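/- arXiv:2208.14350 — 2 statements merged into one kernel-verified Lean document; each statement's English description precedes it below -/
import Mathlib

section
/- Let d ≥ 1 be an integer, B > 0, L > 0, and let φ : ℝ → (B,∞) be strictly increasing and uniformly Lipschitz with Lipschitz constant L. Then for all continuous functions w, w' : [0,1]^d → ℝ, the normalized densities satisfy ∫_{[0,1]^d} |φ_w(x) − φ_{w'}(x)| dx ≤ (2L/B) ∫_{[0,1]^d} |w(x) − w'(x)| dx. -/
open MeasureTheory

noncomputable section

/-- The unit cube `[0,1]^d`. -/
def cube (d : ℕ) : Set (Fin d → ℝ) := Set.Icc 0 1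

/-- The normalized density `φ_w(x) = φ(w(x)) / ∫_{[0,1]^d} φ(w(x')) dx'`. -/
def phiDens (d : ℕ) (φ : ℝ → ℝ) (w : (Fin d → ℝ) → ℝ) (x : Fin d → ℝ) : ℝ :=
  φ (w x) / ∫ x' in cube d, φ (w x')

/-- Normalizing nonnegative functions to integral one is Lipschitz in `L¹`. -/
theorem integral_abs_div_integral_sub_le {α : Type*} [MeasurableSpace α] {μ : Measure α}
    {f g : α → ℝ} (hf : Integrable f μ) (hg : Integrable g μ) (hg0 : ∀ x, 0 ≤ g x)
    {c : ℝ} (hc : 0 < c) (hcf : c ≤ ∫ x, f x ∂μ) (hgpos : 0 < ∫ x, g x ∂μ) :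
    ∫ x, |f x / (∫ y, f y ∂μ) - g x / (∫ y, g y ∂μ)| ∂μ ≤ 2 / c * ∫ x, |f x - g x| ∂μ := by
  have hfg : ∫ x, (f x - g x) ∂μ = (∫ x, f x ∂μ) - ∫ x, g x ∂μ := integral_sub hf hg
  have habs := abs_integral_le_integral_abs (f := fun x => f x - g x) (μ := μ)
  rw [hfg] at habs
  have hfgi : Integrable (fun x => |f x - g x|) μ := (hf.sub hg).abs
  have hD : 0 ≤ ∫ x, |f x - g x| ∂μ := integral_nonneg fun x => abs_nonneg _
  set a := ∫ x, f x ∂μ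
  set b := ∫ x, g x ∂μ
  set D := ∫ x, |f x - g x| ∂μ
  have ha : 0 < a := hc.trans_le hcf
  calc ∫ x, |f x / a - g x / b| ∂μ
      ≤ ∫ x, (|f x - g x| / a + g x * (|a - b| / (a * b))) ∂μ := by
        refine integral_mono ((hf.div_const a).sub (hg.div_const b)).abs
          ((hfgi.div_const a).add (hg.mul_const _)) fun x => ?_
        have hx : f x / a - g x / b = (f x - g x) / a - g x * ((a - b) / (a * b)) := by
          field_simp
          ring
        dsimp only
        rw [hx]
        refine (abs_sub _ _).trans_eq ?_
        rw [abs_div, abs_mul, abs_div, abs_of_pos ha, abs_of_nonneg (hg0 x),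
          abs_of_pos (mul_pos ha hgpos)]
    _ = D / a + b * (|a - b| / (a * b)) := by
        rw [integral_add (hfgi.div_const a) (hg.mul_const _), integral_div, integral_mul_const]
    _ = (D + |a - b|) / a := by field_simp
    _ ≤ (D + D) / c := by gcongr
    _ = 2 / c * D := by ring

theorem stmt3 (d : ℕ) (hd : 1 ≤ d) (B L : ℝ) (hB : 0 < B) (hL : 0 < L)
    (φ : ℝ → ℝ) (hφB : ∀ z, B < φ z) (hφmono : StrictMono φ)
    (hφlip : ∀ a b, |φ a - φ b| ≤ L * |a - b|)
    (w w' : (Fin d → ℝ) → ℝ) (hw : Continuous w) (hw' : Continuous w') :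
    ∫ x in cube d, |phiDens d φ w x - phiDens d φ w' x| ≤
      (2 * L / B) * ∫ x in cube d, |w x - w' x| := by
  have hφc : Continuous φ := by
    refine (LipschitzWith.of_dist_le_mul (K := L.toNNReal) fun a b => ?_).continuous
    simpa [Real.dist_eq, Real.coe_toNNReal L hL.le] using hφlip a b
  have hint {g : (Fin d → ℝ) → ℝ} (hg : Continuous g) : IntegrableOn g (cube d) :=
    hg.continuousOn.integrableOn_compact isCompact_Icc
  have hvol : volume.real (cube d) = 1 := by
    simp [cube, measureReal_def, Real.volume_Icc_pi]
  have hlower {v : (Fin d → ℝ) → ℝ} (hv : Continuous v) : B ≤ ∫ x in cube d, φ (v x) := by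
    have h := integral_mono (hint continuous_const) (hint (hφc.comp hv)) fun x => (hφB (v x)).le
    simpa [hvol] using h
  calc ∫ x in cube d, |phiDens d φ w x - phiDens d φ w' x|
      ≤ 2 / B * ∫ x in cube d, |φ (w x) - φ (w' x)| :=
        integral_abs_div_integral_sub_le (hint (hφc.comp hw)) (hint (hφc.comp hw'))
          (fun x => (hB.trans (hφB _)).le) hB (hlower hw) (hB.trans_le (hlower hw'))
    _ ≤ 2 / B * ∫ x in cube d, L * |w x - w' x| := by
        refine mul_le_mul_of_nonneg_left ?_ (by positivity)
        exact integral_mono (hint ((hφc.comp hw).sub (hφc.comp hw')).abs)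
          (hint ((hw.sub hw').abs.const_mul L)) fun x => hφlip _ _
    _ = (2 * L / B) * ∫ x in cube d, |w x - w' x| := by
        rw [integral_const_mul]
        ring

end
end

section
/- Let d ≥ 1 be an integer, B > 0, L > 0, and let φ : ℝ → (B,∞) be strictly increasing and uniformly Lipschitz with Lipschitz constant L. Then for all continuous functions w, w' : [0,1]^d → ℝ, the Hellinger distance between the normalized densities satisfies d_H(φ_w, φ_{w'}) ≤ (L/B) ( ∫_{[0,1]^d} |w(x) − w'(x)|² dx )^{1/2}. -/
open MeasureTheory

noncomputable section

/-- The Hellinger distance between two nonnegative functions on the unit cube. -/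
def hellinger (d : ℕ) (p q : (Fin d → ℝ) → ℝ) : ℝ :=
  Real.sqrt (∫ x in cube d, (Real.sqrt (p x) - Real.sqrt (q x)) ^ 2)

lemma isCompact_cube (d : ℕ) : IsCompact (cube d) := isCompact_Icc

lemma measureReal_cube (d : ℕ) : volume.real (cube d) = 1 := by
  simp [cube, Measure.real, Real.volume_Icc_pi]

lemma integrableOn_cube {d : ℕ} {f : (Fin d → ℝ) → ℝ} (hf : Continuous f) :
    IntegrableOn f (cube d) :=
  hf.continuousOn.integrableOn_compact (isCompact_cube d)

lemma le_setIntegral_cube {d : ℕ} {f : (Fin d → ℝ) → ℝ} {B : ℝ} (hf : Continuous f)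
    (hB : ∀ x, B ≤ f x) : B ≤ ∫ x in cube d, f x := by
  have h : ∫ _ in cube d, B ≤ ∫ x in cube d, f x :=
    integral_mono (integrableOn_cube continuous_const) (integrableOn_cube hf) hB
  simpa [measureReal_cube] using h

/-- Square roots of numbers bounded below by `B` differ by at most `|s - t| / √B`. -/
lemma mul_sq_sqrt_sub_sqrt_le {B s t : ℝ} (hB : 0 ≤ B) (hs : B ≤ s) (ht : B ≤ t) :
    B * (√s - √t) ^ 2 ≤ (s - t) ^ 2 := by
  have hs' := Real.sq_sqrt (hB.trans hs)
  have ht' := Real.sq_sqrt (hB.trans ht)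
  have h : B ≤ (√s + √t) ^ 2 := by
    nlinarith [mul_nonneg (Real.sqrt_nonneg s) (Real.sqrt_nonneg t)]
  calc B * (√s - √t) ^ 2 ≤ (√s + √t) ^ 2 * (√s - √t) ^ 2 := by gcongr
    _ = (√s ^ 2 - √t ^ 2) ^ 2 := by ring
    _ = (s - t) ^ 2 := by rw [hs', ht']

/-- Normalizing positive functions shrinks the squared Hellinger distance, up to the geometric mean
of the normalizing constants. -/
lemma sqrt_mul_sqrt_mul_integral_le {d : ℕ} {F G : (Fin d → ℝ) → ℝ}
    (hF : Continuous F) (hG : Continuous G) (hF0 : ∀ x, 0 ≤ F x) (hG0 : ∀ x, 0 ≤ G x)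
    (hI : 0 < ∫ x in cube d, F x) (hJ : 0 < ∫ x in cube d, G x) :
    √(∫ x in cube d, F x) * √(∫ x in cube d, G x) *
        ∫ x in cube d, (√(F x / ∫ y in cube d, F y) - √(G x / ∫ y in cube d, G y)) ^ 2 ≤
      ∫ x in cube d, (√(F x) - √(G x)) ^ 2 := by
  set I := ∫ x in cube d, F x with hIdef
  set J := ∫ x in cube d, G x with hJdef
  have ha : 0 < √I := Real.sqrt_pos.2 hI
  have hb : 0 < √J := Real.sqrt_pos.2 hJ
  have haI : √I ^ 2 = I := Real.sq_sqrt hI.le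
  have hbJ : √J ^ 2 = J := Real.sq_sqrt hJ.le
  have hS : IntegrableOn (fun x => (√(F x) - √(G x)) ^ 2) (cube d) :=
    integrableOn_cube (by fun_prop)
  have hF1 : IntegrableOn (fun x => (√J / √I - 1) * F x) (cube d) :=
    integrableOn_cube (by fun_prop)
  have hG1 : IntegrableOn (fun x => (√I / √J - 1) * G x) (cube d) :=
    integrableOn_cube (by fun_prop)
  have hpt : ∀ x, √I * √J * (√(F x / I) - √(G x / J)) ^ 2 =
      (√(F x) - √(G x)) ^ 2 + (√J / √I - 1) * F x + (√I / √J - 1) * G x := by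
    intro x
    rw [Real.sqrt_div (hF0 x), Real.sqrt_div (hG0 x)]
    nth_rewrite 3 [← Real.sq_sqrt (hF0 x)]
    nth_rewrite 3 [← Real.sq_sqrt (hG0 x)]
    field_simp
    ring
  rw [← integral_const_mul]
  simp only [hpt]
  rw [integral_add (by exact hS.add hF1) hG1, integral_add hS hF1, integral_const_mul, integral_const_mul,
    ← hIdef, ← hJdef]
  have h : (√J / √I - 1) * I + (√I / √J - 1) * J = -(√I - √J) ^ 2 := by
    have h' : (√J / √I - 1) * √I ^ 2 + (√I / √J - 1) * √J ^ 2 = -(√I - √J) ^ 2 := by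
      field_simp
      ring
    rwa [haI, hbJ] at h'
  nlinarith [sq_nonneg (√I - √J)]

theorem stmt5 (d : ℕ) (hd : 1 ≤ d) (B L : ℝ) (hB : 0 < B) (hL : 0 < L)
    (φ : ℝ → ℝ) (hφB : ∀ z, B < φ z) (hφmono : StrictMono φ)
    (hφlip : ∀ a b, |φ a - φ b| ≤ L * |a - b|)
    (w w' : (Fin d → ℝ) → ℝ) (hw : Continuous w) (hw' : Continuous w') :
    hellinger d (phiDens d φ w) (phiDens d φ w') ≤
      (L / B) * Real.sqrt (∫ x in cube d, |w x - w' x| ^ 2) := by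
  have hφ : Continuous φ :=
    (LipschitzWith.of_dist_le_mul (K := ⟨L, hL.le⟩) fun a b => hφlip a b).continuous
  have hF : Continuous fun x => φ (w x) := hφ.comp hw
  have hG : Continuous fun x => φ (w' x) := hφ.comp hw'
  have hBI := le_setIntegral_cube hF fun x => (hφB (w x)).le
  have hBJ := le_setIntegral_cube hG fun x => (hφB (w' x)).le
  have hnorm := sqrt_mul_sqrt_mul_integral_le hF hG (fun x => (hB.trans (hφB _)).le)
    (fun x => (hB.trans (hφB _)).le) (hB.trans_le hBI) (hB.trans_le hBJ)
  have hlip : B * ∫ x in cube d, (√(φ (w x)) - √(φ (w' x))) ^ 2 ≤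
      L ^ 2 * ∫ x in cube d, |w x - w' x| ^ 2 := by
    rw [← integral_const_mul, ← integral_const_mul]
    refine integral_mono (integrableOn_cube (by fun_prop)) (integrableOn_cube (by fun_prop))
      fun x => (mul_sq_sqrt_sub_sqrt_le hB.le (hφB _).le (hφB _).le).trans ?_
    rw [← mul_pow, ← sq_abs]
    gcongr
    exact hφlip _ _
  have hBprod : B ≤ √(∫ x in cube d, φ (w x)) * √(∫ x in cube d, φ (w' x)) :=
    calc B = √B * √B := (Real.mul_self_sqrt hB.le).symm
      _ ≤ _ := by gcongr
  unfold hellinger phiDens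
  refine Real.sqrt_le_iff.2 ⟨by positivity, ?_⟩
  rw [mul_pow, Real.sq_sqrt (integral_nonneg fun x => by positivity), div_pow, div_mul_eq_mul_div,
    le_div_iff₀ (by positivity)]
  refine le_trans ?_ hlip
  rw [mul_comm, sq, mul_assoc]
  gcongr
  refine le_trans ?_ hnorm
  gcongr

end
end
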